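/- arXiv:1208.3262 — 6 statements merged into one kernel-verified Lean document; each statement's English description precedes it below -/
import Mathlib

section
/- Let H(a,b,c) be the Gyroid Harper Hamiltonian. Then for all real a,b,c the characteristic polynomial satisfies det(z·I − H(a,b,c)) = z⁴ − 6z² + a₁(a,b,c)·z + a₀(a,b,c), where a₁(a,b,c) = −2cos a − 2cos b − 2cos c − 2cos(a+b+c) and a₀(a,b,c) = 3 − 2cos(a+b) − 2cos(b+c) − 2cos(a+c). -/
open Real Complex Matrix

/-- The Gyroid Harper Hamiltonian. -/
noncomputable def GyroidH (a b c : ℝ) : Matrix (Fin 4) (Fin 4) ℂ :=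
  !![0, 1, 1, 1;
     1, 0, Complex.exp (Complex.I * a), Complex.exp (-(Complex.I * b));
     1, Complex.exp (-(Complex.I * a)), 0, Complex.exp (Complex.I * c);
     1, Complex.exp (Complex.I * b), Complex.exp (-(Complex.I * c)), 0]

/-- Coefficient `a₁` of the characteristic polynomial. -/
noncomputable def gyroidA1 (a b c : ℝ) : ℝ :=
  -2 * Real.cos a - 2 * Real.cos b - 2 * Real.cos c - 2 * Real.cos (a + b + c)

/-- Coefficient `a₀` of the characteristic polynomial. -/
noncomputable def gyroidA0 (a b c : ℝ) : ℝ :=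
  3 - 2 * Real.cos (a + b) - 2 * Real.cos (b + c) - 2 * Real.cos (a + c)

/-- The characteristic determinant of a Hermitian-patterned matrix whose first row is constant `1`,
with arbitrary entries `x, y, w` and `x', y', w'` in the remaining off-diagonal positions. -/
theorem det_smul_one_sub_bordered {R : Type*} [CommRing R] (x x' y y' w w' z : R) :
    Matrix.det (z • (1 : Matrix (Fin 4) (Fin 4) R) -
      !![0, 1, 1, 1; 1, 0, x, y'; 1, x', 0, w; 1, y, w', 0]) =
      z ^ 4 - (3 + x * x' + y * y' + w * w') * z ^ 2
        - (x + x' + y + y' + w + w' + x * y * w + x' * y' * w') * z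
        + (x * x' + y * y' + w * w' - x * y - x' * y' - y * w - y' * w' - x * w - x' * w') := by
  rw [Matrix.det_succ_row_zero]
  simp [Fin.sum_univ_succ, Matrix.det_fin_three, Matrix.one_apply, Fin.succAbove]
  ring

theorem gyroid_charpoly (a b c : ℝ) (z : ℂ) :
    Matrix.det (z • (1 : Matrix (Fin 4) (Fin 4) ℂ) - GyroidH a b c) =
      z ^ 4 - 6 * z ^ 2 + (gyroidA1 a b c : ℂ) * z + (gyroidA0 a b c : ℂ) := by
  have two_cos (t : ℂ) :
      2 * Complex.cos t = Complex.exp (Complex.I * t) + Complex.exp (-(Complex.I * t)) := by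
    rw [Complex.two_cos, neg_mul, mul_comm t]
  have exp_mul_exp_neg (t : ℂ) : Complex.exp t * Complex.exp (-t) = 1 := by
    rw [← Complex.exp_add, add_neg_cancel, Complex.exp_zero]
  rw [GyroidH, det_smul_one_sub_bordered]
  simp only [gyroidA1, gyroidA0]
  push_cast
  simp only [neg_mul, two_cos, mul_add, neg_add, Complex.exp_add]
  have ha := exp_mul_exp_neg (Complex.I * a)
  have hb := exp_mul_exp_neg (Complex.I * b)
  have hc := exp_mul_exp_neg (Complex.I * c)
  linear_combination (1 - z ^ 2) * (ha + hb + hc)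
end

section
/- Let a₁(a,b,c) = −2cos a − 2cos b − 2cos c − 2cos(a+b+c) and a₀(a,b,c) = 3 − 2cos(a+b) − 2cos(b+c) − 2cos(a+c), and let Δ(a₀,a₁) = 256a₀³ − 4608a₀² + 20736a₀ + 864a₁² − 864a₀a₁² − 27a₁⁴ (the discriminant of the quartic z⁴ − 6z² + a₁z + a₀). Then Δ(a₀(a,b,c), a₁(a,b,c)) ≥ 0 for all real a,b,c. -/
open Real

/-- The discriminant of the monic quartic `z⁴ − 6z² + a₁z + a₀`. -/
def quarticDisc (a0 a1 : ℝ) : ℝ :=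
  256 * a0 ^ 3 - 4608 * a0 ^ 2 + 20736 * a0 + 864 * a1 ^ 2 - 864 * a0 * a1 ^ 2 - 27 * a1 ^ 4

/-- The Gyroid Harper Hamiltonian. -/
noncomputable def gyroidHamiltonian (a b c : ℝ) : Matrix (Fin 4) (Fin 4) ℂ :=
  !![0, 1, 1, 1;
     1, 0, Complex.exp (a * Complex.I), Complex.exp (-(b * Complex.I));
     1, Complex.exp (-(a * Complex.I)), 0, Complex.exp (c * Complex.I);
     1, Complex.exp (b * Complex.I), Complex.exp (-(c * Complex.I)), 0]

theorem gyroidHamiltonian_isHermitian (a b c : ℝ) : (gyroidHamiltonian a b c).IsHermitian := by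
  ext i j
  fin_cases i <;> fin_cases j <;> simp [gyroidHamiltonian, ← Complex.exp_conj]

theorem gyroidHamiltonian_charpoly_eval (a b c : ℝ) (z : ℂ) :
    (gyroidHamiltonian a b c).charpoly.eval z =
      z ^ 4 - 6 * z ^ 2 + (gyroidA1 a b c : ℂ) * z + (gyroidA0 a b c : ℂ) := by
  have ha : Complex.exp (a * Complex.I) * Complex.exp (-(a * Complex.I)) = 1 := by
    rw [← Complex.exp_add, add_neg_cancel, Complex.exp_zero]
  have hb : Complex.exp (b * Complex.I) * Complex.exp (-(b * Complex.I)) = 1 := by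
    rw [← Complex.exp_add, add_neg_cancel, Complex.exp_zero]
  have hc : Complex.exp (c * Complex.I) * Complex.exp (-(c * Complex.I)) = 1 := by
    rw [← Complex.exp_add, add_neg_cancel, Complex.exp_zero]
  have hM : Matrix.scalar (Fin 4) z - gyroidHamiltonian a b c =
      !![z, -1, -1, -1;
         -1, z, -Complex.exp (a * Complex.I), -Complex.exp (-(b * Complex.I));
         -1, -Complex.exp (-(a * Complex.I)), z, -Complex.exp (c * Complex.I);
         -1, -Complex.exp (b * Complex.I), -Complex.exp (-(c * Complex.I)), z] := by
    ext i j
    fin_cases i <;> fin_cases j <;> simp [gyroidHamiltonian]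
  rw [Matrix.eval_charpoly, hM, gyroidA1, gyroidA0]
  push_cast
  simp only [Complex.cos, add_mul, neg_mul, neg_add, Complex.exp_add]
  generalize Complex.exp (a * Complex.I) = x, Complex.exp (-(a * Complex.I)) = x',
    Complex.exp (b * Complex.I) = y, Complex.exp (-(b * Complex.I)) = y',
    Complex.exp (c * Complex.I) = w, Complex.exp (-(c * Complex.I)) = w' at *
  simp [Matrix.det_succ_row_zero, Fin.sum_univ_succ, Fin.succAbove]
  linear_combination (1 - z ^ 2) * (ha + hb + hc)

/-- The discriminant of a depressed quartic with four real roots is nonnegative. -/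
theorem depressed_quartic_disc_nonneg {p q r : ℝ} (l : Fin 4 → ℝ)
    (h : ∀ z : ℝ, z ^ 4 + p * z ^ 2 + q * z + r = ∏ i, (z - l i)) :
    0 ≤ 16 * p ^ 4 * r - 4 * p ^ 3 * q ^ 2 - 128 * p ^ 2 * r ^ 2 + 144 * p * q ^ 2 * r
      - 27 * q ^ 4 + 256 * r ^ 3 := by
  simp only [Fin.prod_univ_four] at h
  generalize l 0 = s, l 1 = t, l 2 = u, l 3 = v at h
  have h0 := h 0
  have h1 := h 1
  have h2 := h (-1)
  have h3 := h 2
  obtain rfl : v = -(s + t + u) := by linear_combination (h3 - 3 * h1 - h2 + 3 * h0) / 6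
  obtain rfl : p = s * t + (s + t) * u - (s + t + u) ^ 2 := by
    linear_combination (h1 + h2 - 2 * h0) / 2
  obtain rfl : r = - (s * t * u * (s + t + u)) := by linear_combination h0
  obtain rfl : q = (s + t) * (t + u) * (s + u) := by linear_combination (h1 - h2) / 2
  have : 0 ≤ ((s - t) * (s - u) * (t - u) * (2 * s + t + u) * (s + 2 * t + u)
    * (s + t + 2 * u)) ^ 2 := sq_nonneg _
  linarith

theorem gyroid_disc_nonneg (a b c : ℝ) :
    0 ≤ quarticDisc (gyroidA0 a b c) (gyroidA1 a b c) := by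
  have hH := gyroidHamiltonian_isHermitian a b c
  have h := depressed_quartic_disc_nonneg (p := -6) (q := gyroidA1 a b c) (r := gyroidA0 a b c)
    hH.eigenvalues fun z ↦ by
      have hz := gyroidHamiltonian_charpoly_eval a b c z
      rw [hH.charpoly_eq, Polynomial.eval_prod] at hz
      simp only [Polynomial.eval_sub, Polynomial.eval_X, Polynomial.eval_C] at hz
      have : z ^ 4 - 6 * z ^ 2 + gyroidA1 a b c * z + gyroidA0 a b c =
          ∏ i, (z - hH.eigenvalues i) := by
        apply Complex.ofReal_injective
        push_cast
        exact hz.symm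
      linarith
  unfold quarticDisc
  linarith
end

section
/- Let P(a,b,c,z) = z⁴ − 6z² + (−2cos a − 2cos b − 2cos c − 2cos(a+b+c))·z + (3 − 2cos(a+b) − 2cos(b+c) − 2cos(a+c)) as a smooth real function on ℝ⁴. Then the set of points (a,b,c,z) with a,b,c ∈ [0,2π) satisfying simultaneously P = 0, ∂P/∂a = 0, ∂P/∂b = 0, ∂P/∂c = 0 and ∂P/∂z = 0 is exactly the six points {(0,0,0,−1), (π,π,π,1), (π/2,π/2,π/2,√3), (π/2,π/2,π/2,−√3), (3π/2,3π/2,3π/2,√3), (3π/2,3π/2,3π/2,−√3)}. -/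
open Real

/-- The characteristic polynomial of the Gyroid Harper Hamiltonian, as a
smooth real function of `(a, b, c, z)`. -/
noncomputable def P (a b c z : ℝ) : ℝ :=
  z ^ 4 - 6 * z ^ 2
    + (-2 * Real.cos a - 2 * Real.cos b - 2 * Real.cos c - 2 * Real.cos (a + b + c)) * z
    + (3 - 2 * Real.cos (a + b) - 2 * Real.cos (b + c) - 2 * Real.cos (a + c))

/-- Partial derivative in the first variable. -/
noncomputable def pda (f : ℝ → ℝ → ℝ → ℝ → ℝ) (a b c z : ℝ) : ℝ :=
  deriv (fun t => f t b c z) a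

/-- Partial derivative in the second variable. -/
noncomputable def pdb (f : ℝ → ℝ → ℝ → ℝ → ℝ) (a b c z : ℝ) : ℝ :=
  deriv (fun t => f a t c z) b

/-- Partial derivative in the third variable. -/
noncomputable def pdc (f : ℝ → ℝ → ℝ → ℝ → ℝ) (a b c z : ℝ) : ℝ :=
  deriv (fun t => f a b t z) c

/-- Partial derivative in the fourth variable. -/
noncomputable def pdz (f : ℝ → ℝ → ℝ → ℝ → ℝ) (a b c z : ℝ) : ℝ :=
  deriv (fun t => f a b c t) z

theorem pda_P (a b c z : ℝ) :
    pda P a b c z =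
      2 * (sin a + sin (a + b + c)) * z + 2 * (sin (a + b) + sin (a + c)) := by
  have hab : HasDerivAt (fun t => t + b) 1 a := (hasDerivAt_id a).add_const b
  have hac : HasDerivAt (fun t => t + c) 1 a := (hasDerivAt_id a).add_const c
  have h := ((((((hasDerivAt_cos a).const_mul (-2)).sub_const (2 * cos b)).sub_const
    (2 * cos c)).sub ((hab.add_const c).cos.const_mul 2)).mul_const z).const_add (z ^ 4 - 6 * z ^ 2)
    |>.add (((hab.cos.const_mul 2).const_sub 3).sub_const (2 * cos (b + c)) |>.sub
      (hac.cos.const_mul 2))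
  exact h.deriv.trans (by ring)

theorem P_swap_first (a b c z : ℝ) : P a b c z = P b a c z := by
  unfold P
  rw [add_comm a b]
  ring

theorem P_swap_last (a b c z : ℝ) : P a b c z = P a c b z := by
  unfold P
  rw [add_right_comm a b c, add_comm b c]
  ring

theorem pdb_P (a b c z : ℝ) : pdb P a b c z = pda P b a c z := by
  simp only [pda, pdb, P_swap_first a]

theorem pdc_P (a b c z : ℝ) : pdc P a b c z = pda P c a b z := by
  simp only [pda, pdc, P_swap_last a b, P_swap_first a]

theorem pdz_P (a b c z : ℝ) :
    pdz P a b c z =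
      4 * z ^ 3 - 12 * z - 2 * (cos a + cos b + cos c + cos (a + b + c)) := by
  have h := (((hasDerivAt_pow 4 z).sub ((hasDerivAt_pow 2 z).const_mul 6)).add
    ((hasDerivAt_id z).const_mul
      (-2 * cos a - 2 * cos b - 2 * cos c - 2 * cos (a + b + c)))).add_const
    (3 - 2 * cos (a + b) - 2 * cos (b + c) - 2 * cos (a + c))
  exact h.deriv.trans (by norm_num; ring)

/-- The principal `3 × 3` minor of `z • 1 - H` belonging to a triangle of flux `t`. -/
noncomputable def fluxMinor (t z : ℝ) : ℝ := z ^ 3 - 3 * z - 2 * cos t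

/-- Jacobi's identity for a `2 × 2` block of the adjugate of `z • 1 - H`: the difference
`fluxMinor a z * fluxMinor b z - (z ^ 2 - 1) * P a b c z` is the squared modulus of an
off-diagonal cofactor. -/
theorem fluxMinor_mul_sub (a b c z : ℝ) :
    fluxMinor a z * fluxMinor b z - (z ^ 2 - 1) * P a b c z =
      (z ^ 2 - 1 + z * (cos c + cos (a + b + c)) + cos (b + c) + cos (a + c)) ^ 2 +
        (z * (sin c + sin (a + b + c)) + sin (b + c) + sin (a + c)) ^ 2 := by
  have ha := sin_sq_add_cos_sq a
  have hb := sin_sq_add_cos_sq b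
  have hc := sin_sq_add_cos_sq c
  simp only [fluxMinor, P, cos_add, sin_add]
  grind

theorem P_fourth_flux (a b c z : ℝ) : P a b (-(a + b + c)) z = P a b c z := by
  unfold P
  rw [cos_neg, show a + b + -(a + b + c) = -c by ring, show b + -(a + b + c) = -(a + c) by ring,
    show a + -(a + b + c) = -(b + c) by ring, cos_neg, cos_neg, cos_neg]
  ring

theorem fluxMinor_neg (t z : ℝ) : fluxMinor (-t) z = fluxMinor t z := by
  simp [fluxMinor]

theorem fluxMinor_mul_nonneg {a b c z : ℝ} (h : P a b c z = 0) :
    0 ≤ fluxMinor a z * fluxMinor b z := by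
  have := fluxMinor_mul_sub a b c z
  rw [h, mul_zero, sub_zero] at this
  rw [this]
  positivity

/-- At a multiple root all principal `3 × 3` minors vanish. -/
theorem fluxMinor_eq_zero {a b c z : ℝ} (h : P a b c z = 0) (hz : pdz P a b c z = 0) :
    fluxMinor a z = 0 ∧ fluxMinor b z = 0 ∧ fluxMinor c z = 0 ∧
      fluxMinor (a + b + c) z = 0 := by
  have hsum : fluxMinor a z + fluxMinor b z + fluxMinor c z + fluxMinor (a + b + c) z = 0 := by
    rw [pdz_P] at hz
    unfold fluxMinor
    linear_combination hz
  have hacb : P a c b z = 0 := by rw [← P_swap_last, h]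
  have hbca : P b c a z = 0 := by rw [P_swap_last, P_swap_first, P_swap_last, ← h, P_swap_last]
  have hab := fluxMinor_mul_nonneg h
  have hac := fluxMinor_mul_nonneg hacb
  have hbc := fluxMinor_mul_nonneg hbca
  have had : 0 ≤ fluxMinor a z * fluxMinor (a + b + c) z := by
    rw [← fluxMinor_neg (a + b + c)]
    exact fluxMinor_mul_nonneg (c := b) (by rw [← P_swap_last, P_fourth_flux, h])
  have hbd : 0 ≤ fluxMinor b z * fluxMinor (a + b + c) z := by
    rw [← fluxMinor_neg (a + b + c)]
    exact fluxMinor_mul_nonneg (c := a)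
      (by rw [P_swap_last, P_swap_first, P_fourth_flux, h])
  have hcd : 0 ≤ fluxMinor c z * fluxMinor (a + b + c) z := by
    rw [← fluxMinor_neg (a + b + c), add_right_comm a b c]
    exact fluxMinor_mul_nonneg (c := a)
      (by rw [P_swap_last, P_swap_first, P_fourth_flux, hacb])
  generalize fluxMinor a z = p at *
  generalize fluxMinor b z = q at *
  generalize fluxMinor c z = r at *
  generalize fluxMinor (a + b + c) z = s at *
  have hsq : p ^ 2 + q ^ 2 + r ^ 2 + s ^ 2 +
      2 * (p * q + p * r + q * r + p * s + q * s + r * s) = 0 := by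
    linear_combination (p + q + r + s) * hsum
  refine ⟨?_, ?_, ?_, ?_⟩ <;> refine pow_eq_zero_iff two_ne_zero |>.mp ?_ <;>
    nlinarith [sq_nonneg p, sq_nonneg q, sq_nonneg r, sq_nonneg s]

theorem eq_of_cos_eq_of_sin_eq {s t : ℝ} (hs : s ∈ Set.Ico 0 (2 * π))
    (ht : t ∈ Set.Ico 0 (2 * π)) (hcos : cos s = cos t) (hsin : sin s = sin t) : s = t := by
  have h : cos (s - t) = 1 := by
    rw [cos_sub, hcos, hsin]
    linear_combination sin_sq_add_cos_sq t
  rw [cos_eq_one_iff_of_lt_of_lt (by linarith [hs.1, ht.2]) (by linarith [hs.2, ht.1])] at h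
  exact sub_eq_zero.mp h

/-- The trigonometric values at a multiple root. -/
theorem cos_sin_of_fluxMinor_eq_zero {a b c z : ℝ} (h : P a b c z = 0)
    (ha : fluxMinor a z = 0) (hb : fluxMinor b z = 0) (hc : fluxMinor c z = 0)
    (hd : fluxMinor (a + b + c) z = 0) :
    cos b = cos a ∧ cos c = cos a ∧ sin b = sin a ∧ sin c = sin a ∧
      (cos a = 1 ∧ sin a = 0 ∧ z = -1 ∨ cos a = -1 ∧ sin a = 0 ∧ z = 1 ∨
        cos a = 0 ∧ (sin a = 1 ∨ sin a = -1) ∧ z ^ 2 = 3) := by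
  have hba : cos b = cos a := by unfold fluxMinor at *; linarith
  have hca : cos c = cos a := by unfold fluxMinor at *; linarith
  have hda : cos (a + b + c) = cos a := by unfold fluxMinor at *; linarith
  have hsa := sin_sq_add_cos_sq a
  have hsb := sin_sq_add_cos_sq b
  have hsc := sin_sq_add_cos_sq c
  have hz : z ^ 3 - 3 * z = 2 * cos a := by unfold fluxMinor at *; linarith
  unfold P at h
  rw [hda, hba, hca] at h
  simp only [cos_add, sin_add, hba, hca] at h hda hsb hsc
  generalize cos a = x at *
  generalize sin a = s at *
  have hb' : sin b = s ∨ sin b = -s := sq_eq_sq_iff_eq_or_eq_neg.mp (by linarith)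
  have hc' : sin c = s ∨ sin c = -s := sq_eq_sq_iff_eq_or_eq_neg.mp (by linarith)
  generalize sin b = t at *
  generalize sin c = u at *
  have key : z ^ 2 = 1 ∨ t = s ∧ u = s := by
    rcases hb' with rfl | rfl <;> rcases hc' with rfl | rfl
    · exact .inr ⟨rfl, rfl⟩
    all_goals
      refine .inl (sub_eq_zero.mp (pow_eq_zero_iff three_ne_zero |>.mp ?_))
      grind
  have hsq_zero (w : ℝ) (hw : w ^ 2 = 0) : w = 0 := pow_eq_zero_iff two_ne_zero |>.mp hw
  rcases key with hz1 | ⟨rfl, rfl⟩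
  · rcases sq_eq_one_iff.mp hz1 with rfl | rfl
    · obtain rfl : x = -1 := by linarith
      have := hsq_zero s (by linarith)
      grind
    · obtain rfl : x = 1 := by linarith
      have := hsq_zero s (by linarith)
      grind
  · refine ⟨hba, hca, rfl, rfl, ?_⟩
    have hxu : x * u ^ 2 = 0 := by grind
    rcases mul_eq_zero.mp hxu with rfl | hu
    · have hu1 : u = 1 ∨ u = -1 := sq_eq_one_iff.mp (by linarith)
      have hz0 : z * (z ^ 2 - 3) = 0 := by linear_combination hz
      rcases mul_eq_zero.mp hz0 with rfl | hz3
      · exfalso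
        rcases hu1 with rfl | rfl <;> norm_num at h
      · exact .inr (.inr ⟨rfl, hu1, by linarith⟩)
    · obtain rfl := hsq_zero u hu
      rcases sq_eq_one_iff.mp (show x ^ 2 = 1 by linarith) with rfl | rfl
      · refine .inl ⟨rfl, rfl, ?_⟩
        grind
      · refine .inr (.inl ⟨rfl, rfl, ?_⟩)
        grind

theorem gyroid_critical_points :
    {p : ℝ × ℝ × ℝ × ℝ |
        p.1 ∈ Set.Ico 0 (2 * π) ∧ p.2.1 ∈ Set.Ico 0 (2 * π) ∧ p.2.2.1 ∈ Set.Ico 0 (2 * π) ∧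
        P p.1 p.2.1 p.2.2.1 p.2.2.2 = 0 ∧
        pda P p.1 p.2.1 p.2.2.1 p.2.2.2 = 0 ∧
        pdb P p.1 p.2.1 p.2.2.1 p.2.2.2 = 0 ∧
        pdc P p.1 p.2.1 p.2.2.1 p.2.2.2 = 0 ∧
        pdz P p.1 p.2.1 p.2.2.1 p.2.2.2 = 0} =
      {((0 : ℝ), (0 : ℝ), (0 : ℝ), (-1 : ℝ)), (π, π, π, (1 : ℝ)),
       (π / 2, π / 2, π / 2, Real.sqrt 3), (π / 2, π / 2, π / 2, -Real.sqrt 3),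
       (3 * π / 2, 3 * π / 2, 3 * π / 2, Real.sqrt 3),
       (3 * π / 2, 3 * π / 2, 3 * π / 2, -Real.sqrt 3)} := by
  ext ⟨a, b, c, z⟩
  simp only [Set.mem_ofPred_eq, Set.mem_insert_iff, Set.mem_singleton_iff, Prod.mk.injEq]
  have hpi := pi_pos
  have hsqrt : √3 ^ 2 = 3 := sq_sqrt (by norm_num)
  have hcos3 : cos (3 * π / 2) = 0 := by
    rw [show 3 * π / 2 = π / 2 + π by ring, cos_add_pi, cos_pi_div_two, neg_zero]
  have hsin3 : sin (3 * π / 2) = -1 := by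
    rw [show 3 * π / 2 = π / 2 + π by ring, sin_add_pi, sin_pi_div_two]
  have mem0 : (0 : ℝ) ∈ Set.Ico 0 (2 * π) := ⟨le_rfl, by positivity⟩
  have mem1 : π ∈ Set.Ico 0 (2 * π) := ⟨hpi.le, by linarith⟩
  have mem2 : π / 2 ∈ Set.Ico 0 (2 * π) := ⟨by positivity, by linarith⟩
  have mem3 : 3 * π / 2 ∈ Set.Ico 0 (2 * π) := ⟨by positivity, by linarith⟩
  constructor
  · rintro ⟨ha, hb, hc, h, -, -, -, hz⟩
    obtain ⟨pa, pb, pc, pd⟩ := fluxMinor_eq_zero h hz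
    obtain ⟨hba, hca, hba', hca', hcase⟩ := cos_sin_of_fluxMinor_eq_zero h pa pb pc pd
    obtain rfl := eq_of_cos_eq_of_sin_eq hb ha hba hba'
    obtain rfl := eq_of_cos_eq_of_sin_eq hc ha hca hca'
    have hroot (hz3 : z ^ 2 = 3) : z = √3 ∨ z = -√3 :=
      sq_eq_sq_iff_eq_or_eq_neg.mp (hz3.trans hsqrt.symm)
    rcases hcase with ⟨hx, hs, rfl⟩ | ⟨hx, hs, rfl⟩ | ⟨hx, hs | hs, hz3⟩
    · have := eq_of_cos_eq_of_sin_eq ha mem0 (by simp [hx]) (by simp [hs])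
      exact .inl ⟨this, this, this, rfl⟩
    · have := eq_of_cos_eq_of_sin_eq ha mem1 (by simp [hx]) (by simp [hs])
      exact .inr (.inl ⟨this, this, this, rfl⟩)
    · have := eq_of_cos_eq_of_sin_eq ha mem2 (by simp [hx]) (by simp [hs])
      rcases hroot hz3 with h3 | h3
      · exact .inr (.inr (.inl ⟨this, this, this, h3⟩))
      · exact .inr (.inr (.inr (.inl ⟨this, this, this, h3⟩)))
    · have := eq_of_cos_eq_of_sin_eq ha mem3 (by rw [hx, hcos3]) (by rw [hs, hsin3])
      rcases hroot hz3 with h3 | h3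
      · exact .inr (.inr (.inr (.inr (.inl ⟨this, this, this, h3⟩))))
      · exact .inr (.inr (.inr (.inr (.inr ⟨this, this, this, h3⟩))))
  · simp only [pdb_P, pdc_P, pda_P, pdz_P, P]
    rintro (⟨rfl, rfl, rfl, rfl⟩ | ⟨rfl, rfl, rfl, rfl⟩ | ⟨rfl, rfl, rfl, rfl⟩ |
      ⟨rfl, rfl, rfl, rfl⟩ | ⟨rfl, rfl, rfl, rfl⟩ | ⟨rfl, rfl, rfl, rfl⟩)
    · refine ⟨mem0, mem0, mem0, ?_⟩
      norm_num
    · refine ⟨mem1, mem1, mem1, ?_⟩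
      norm_num [cos_add, sin_add]
    all_goals
      first
      | refine ⟨mem2, mem2, mem2, ?_⟩
      | refine ⟨mem3, mem3, mem3, ?_⟩
      simp only [cos_add, sin_add, cos_pi_div_two, sin_pi_div_two, hcos3, hsin3]
      grind
end

section
/- Let H(a,b,c) be the Gyroid Harper Hamiltonian. Then det(z·I − H(0,0,0)) = (z+1)³(z−3) and det(z·I − H(π,π,π)) = (z−1)³(z+3); in particular H(0,0,0) has eigenvalue −1 with multiplicity 3 and simple eigenvalue 3, and H(π,π,π) has eigenvalue 1 with multiplicity 3 and simple eigenvalue −3 (triple level crossings). -/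
open Real Matrix

theorem gyroid_triple_crossings :
    (∀ z : ℂ, Matrix.det (z • (1 : Matrix (Fin 4) (Fin 4) ℂ) - GyroidH 0 0 0) =
        (z + 1) ^ 3 * (z - 3)) ∧
    (∀ z : ℂ, Matrix.det (z • (1 : Matrix (Fin 4) (Fin 4) ℂ) - GyroidH π π π) =
        (z - 1) ^ 3 * (z + 3)) := by
  have h_exp : Complex.exp (Complex.I * π) = -1 := by
    rw [mul_comm, Complex.exp_pi_mul_I]
  have h_exp_neg : Complex.exp (-(Complex.I * π)) = -1 := by
    rw [Complex.exp_neg, h_exp]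
    norm_num
  constructor <;> intro z
  · simp [GyroidH, Matrix.det_succ_row_zero, Fin.sum_univ_succ, Fin.succAbove, Matrix.one_apply]
    ring
  · simp [GyroidH, h_exp, h_exp_neg, Matrix.det_succ_row_zero, Fin.sum_univ_succ, Fin.succAbove,
      Matrix.one_apply]
    ring
end

section
/- Let H(a,b,c) be the Gyroid Harper Hamiltonian. Then det(z·I − H(π/2,π/2,π/2)) = (z² − 3)² and det(z·I − H(3π/2,3π/2,3π/2)) = (z² − 3)²; in particular at each of these two points H has exactly the eigenvalues √3 and −√3, each with multiplicity 2 (two simultaneous double level crossings). -/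
open Real Matrix

theorem det_smul_one_sub_gyroidH_of_exp {θ : ℝ} {u : ℂ} (hu : Complex.exp (Complex.I * θ) = u)
    (hu2 : u ^ 2 = -1) (z : ℂ) :
    Matrix.det (z • (1 : Matrix (Fin 4) (Fin 4) ℂ) - GyroidH θ θ θ) = (z ^ 2 - 3) ^ 2 := by
  have hinv : Complex.exp (-(Complex.I * θ)) = -u := by
    rw [Complex.exp_neg, hu]
    exact inv_eq_of_mul_eq_one_right (by linear_combination -hu2)
  rw [GyroidH, hu, hinv]
  simp [Matrix.det_succ_row_zero, Fin.sum_univ_succ, Matrix.one_apply, Fin.succAbove]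
  grind

theorem gyroid_double_crossings :
    (∀ z : ℂ, Matrix.det (z • (1 : Matrix (Fin 4) (Fin 4) ℂ) - GyroidH (π / 2) (π / 2) (π / 2)) =
        (z ^ 2 - 3) ^ 2) ∧
    (∀ z : ℂ, Matrix.det (z • (1 : Matrix (Fin 4) (Fin 4) ℂ) -
          GyroidH (3 * π / 2) (3 * π / 2) (3 * π / 2)) =
        (z ^ 2 - 3) ^ 2) := by
  refine ⟨det_smul_one_sub_gyroidH_of_exp (u := Complex.I) ?_ Complex.I_sq,
    det_smul_one_sub_gyroidH_of_exp (u := -Complex.I) ?_ (by simp)⟩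
  · push_cast
    rw [mul_comm, Complex.exp_pi_div_two_mul_I]
  · have h : Complex.I * ((3 * π / 2 : ℝ) : ℂ) = π * Complex.I + π / 2 * Complex.I := by
      push_cast
      ring
    rw [h, Complex.exp_add, Complex.exp_pi_mul_I, Complex.exp_pi_div_two_mul_I, neg_one_mul]
end

section
/- Let H(a,b,c) be the Gyroid Harper Hamiltonian. Then for all real a, det(z·I − H(a,a,a)) = (z − 2cos(a + 2π/3))·(z − 2cos(a − 2π/3))·(z² − 2z·cos a − 3); in particular the eigenvalues of H(a,a,a) are 2cos(a+2π/3), 2cos(a−2π/3), and cos a ± √(cos²a + 3). -/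
open Real Matrix

theorem Real.cos_two_pi_div_three : cos (2 * π / 3) = -(1 / 2) := by
  rw [show 2 * π / 3 = π - π / 3 by ring, cos_pi_sub, cos_pi_div_three]

theorem sub_two_cos_add_mul_sub_two_cos_sub (a : ℝ) (z : ℂ) :
    (z - (2 * Real.cos (a + 2 * π / 3) : ℝ)) * (z - (2 * Real.cos (a - 2 * π / 3) : ℝ)) =
      z ^ 2 + 2 * z * (Real.cos a : ℝ) + 4 * (Real.cos a : ℝ) ^ 2 - 3 := by
  have hsum : 2 * cos (a + 2 * π / 3) + 2 * cos (a - 2 * π / 3) = -2 * cos a := by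
    rw [cos_add, cos_sub, Real.cos_two_pi_div_three]
    ring
  have hmul : 2 * cos (a + 2 * π / 3) * (2 * cos (a - 2 * π / 3)) = 4 * cos a ^ 2 - 3 := by
    have h := sin_sq_add_cos_sq (2 * π / 3)
    rw [cos_add, cos_sub]
    rw [Real.cos_two_pi_div_three] at h ⊢
    linear_combination -4 * sin a ^ 2 * h - 3 * sin_sq_add_cos_sq a
  have hsum' := congrArg Complex.ofReal hsum
  have hmul' := congrArg Complex.ofReal hmul
  push_cast at hsum' hmul' ⊢
  linear_combination -z * hsum' + hmul'

theorem det_smul_one_sub_gyroidH_diagonal (a : ℝ) (z : ℂ) :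
    Matrix.det (z • (1 : Matrix (Fin 4) (Fin 4) ℂ) - GyroidH a a a) =
      (z ^ 2 + 2 * z * (Real.cos a : ℝ) + 4 * (Real.cos a : ℝ) ^ 2 - 3) *
        (z ^ 2 - 2 * z * (Real.cos a : ℝ) - 3) := by
  have hcos : (Real.cos a : ℂ) =
      (Complex.exp (Complex.I * a) + Complex.exp (-(Complex.I * a))) / 2 := by
    rw [Complex.ofReal_cos, Complex.cos, neg_mul, mul_comm (a : ℂ)]
  have huv : Complex.exp (Complex.I * a) * Complex.exp (-(Complex.I * a)) = 1 := by
    rw [← Complex.exp_add, add_neg_cancel, Complex.exp_zero]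
  rw [hcos, GyroidH]
  generalize Complex.exp (Complex.I * a) = u at *
  generalize Complex.exp (-(Complex.I * a)) = v at *
  simp [Matrix.det_succ_row_zero, Fin.sum_univ_succ, Fin.succAbove, Matrix.one_apply]
  ring_nf
  linear_combination (9 + 3 * z * (u + v) - 3 * z ^ 2) * huv

theorem gyroid_diagonal_spectrum (a : ℝ) (z : ℂ) :
    Matrix.det (z • (1 : Matrix (Fin 4) (Fin 4) ℂ) - GyroidH a a a) =
      (z - (2 * Real.cos (a + 2 * π / 3) : ℝ)) * (z - (2 * Real.cos (a - 2 * π / 3) : ℝ)) *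
        (z ^ 2 - 2 * z * (Real.cos a : ℝ) - 3) := by
  rw [sub_two_cos_add_mul_sub_two_cos_sub, det_smul_one_sub_gyroidH_diagonal]
end
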